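/- Let G and H be reflexive weakly connected digraphs, α, β : G → H homomorphisms, and q ∈ V(G), and suppose the set of walks \bar H-realizable for α, β, q (via push-or-pull recoloring sequences of the underlying undirected graphs) equals {RⁿP : n ∈ ℤ} for some R, P ∈ π(\bar H) with R a closed walk at α(q). Write R = A · R₀ · A⁻¹ with A reduced and R₀ cyclically reduced, let a₀ := ⌈|V(G)|/|R₀|⌉ and N := 3a₀ + ⌈(|P| + |V(G)|)/|R₀|⌉. If RⁿP is not H-realizable for every integer n with −N ≤ n ≤ N, then RⁿP is not H-realizable for every n ∈ ℤ. -/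

import Mathlib

namespace HRecoloring

/-- A digraph: a vertex type together with an arc relation. -/
structure Dgraph (V : Type) where
  Adj : V → V → Prop

variable {V X : Type}

/-- Adjacency in the underlying undirected graph. -/
def Dgraph.UAdj (G : Dgraph V) (u v : V) : Prop := G.Adj u v ∨ G.Adj v u

/-- A digraph is loopless if it has no arc `v → v`. -/
def Dgraph.Loopless (G : Dgraph V) : Prop := ∀ v, ¬ G.Adj v v

/-- A digraph is reflexive if `v → v` for every vertex `v`. -/
def Dgraph.IsReflexive (G : Dgraph V) : Prop := ∀ v, G.Adj v v

/-- A symmetric digraph, which we identify with an undirected graph. -/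
def Dgraph.IsSymmetric (G : Dgraph V) : Prop := ∀ u v, G.Adj u v → G.Adj v u

/-- The underlying undirected graph, as a symmetric digraph. -/
def Dgraph.usym (G : Dgraph V) : Dgraph V := ⟨fun u v => G.UAdj u v⟩

/-- A (di)graph homomorphism. -/
def IsHom (G : Dgraph V) (H : Dgraph X) (f : V → X) : Prop :=
  ∀ ⦃u v⦄, G.Adj u v → H.Adj (f u) (f v)

/-- A walk from `a` to `b`, encoded by its list of successive vertices.
A walk in a digraph is a walk in its underlying undirected graph. -/
def IsWalk (G : Dgraph V) (a b : V) (l : List V) : Prop :=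
  l ≠ [] ∧ l.head? = some a ∧ l.getLast? = some b ∧ l.Chain' G.UAdj

/-- Weak connectivity. -/
def Dgraph.WConn (G : Dgraph V) : Prop := ∀ u v : V, ∃ l, IsWalk G u v l

/-- Concatenation of two walks sharing an endpoint. -/
def wcomp (l₁ l₂ : List V) : List V := l₁ ++ l₂.tail

/-- Number of edges of a walk. -/
def wlen (l : List V) : ℕ := l.length - 1

/-- One reduction step on walks: delete a backtracking pair `(x y)(y x)` or a
one-edge loop step `(x x)`. -/
def RStep (l l' : List V) : Prop :=
  (∃ (p s : List V) (x y : V), l = p ++ [x, y, x] ++ s ∧ l' = p ++ [x] ++ s) ∨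
  (∃ (p s : List V) (x : V), l = p ++ [x, x] ++ s ∧ l' = p ++ [x] ++ s)

/-- Equality of walks in the fundamental groupoid `π(H)`: the equivalence
generated by reduction steps (two walks are equal in `π(H)` iff they reduce to
the same reduced walk). -/
def PiEq (l l' : List V) : Prop := Relation.EqvGen RStep l l'

/-- A walk is reduced if no reduction step applies to it. -/
def IsReduced (l : List V) : Prop := ∀ l', ¬ RStep l l'

/-- A closed walk is cyclically reduced if it is reduced and its first and last
edges are not inverses of each other. -/
def IsCycReduced (l : List V) : Prop :=
  IsReduced l ∧ ∃ h : 2 ≤ l.length,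
    l.get ⟨1, by omega⟩ ≠ l.get ⟨l.length - 2, by omega⟩

/-- `n`-fold concatenation of a closed walk `R` based at `h`. -/
def witer (R : List V) (h : V) : ℕ → List V
  | 0 => [h]
  | n + 1 => wcomp R (witer R h n)

/-- `Rⁿ` for an integer `n`, for a closed walk `R` based at `h`; for `n < 0`
this is the `|n|`-fold concatenation of the reversed walk `R⁻¹`. -/
def zpowWalk (R : List V) (h : V) (n : ℤ) : List V :=
  if 0 ≤ n then witer R h n.toNat else witer R.reverse h (-n).toNat

/-- A walk is symmetric if every edge it traverses is a symmetric arc. -/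
def IsSymWalk (H : Dgraph X) (l : List X) : Prop :=
  l.Chain' fun a b => H.Adj a b ∧ H.Adj b a

/-- The conjugated walk `α(W)⁻¹ · Q · β(W)`. -/
def conj (α β : V → X) (Wl : List V) (Q : List X) : List X :=
  wcomp (wcomp (Wl.map α).reverse Q) (Wl.map β)

/-- Topological validity of a walk `Q` from `α q` to `β q`:
`β(C) = Q⁻¹ · α(C) · Q` in `π(H)` for every closed walk `C` at `q`. -/
def TopValid (G : Dgraph V) (H : Dgraph X) (α β : V → X) (q : V) (Q : List X) : Prop :=
  ∀ C : List V, IsWalk G q q C →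
    PiEq (C.map β) (wcomp (wcomp Q.reverse (C.map α)) Q)

/-- IN-zigzag pattern `a₁ ← a₂ → a₃ ← … ← a_{n-1} → a_n`. -/
def INCompatible (H : Dgraph X) (l : List X) : Prop :=
  ∀ (i : ℕ) (h : i + 1 < l.length),
    if i % 2 = 0 then H.Adj (l.get ⟨i + 1, h⟩) (l.get ⟨i, by omega⟩)
    else H.Adj (l.get ⟨i, by omega⟩) (l.get ⟨i + 1, h⟩)

/-- OUT-zigzag pattern `a₁ → a₂ ← a₃ → … → a_{n-1} ← a_n`. -/
def OUTCompatible (H : Dgraph X) (l : List X) : Prop :=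
  ∀ (i : ℕ) (h : i + 1 < l.length),
    if i % 2 = 0 then H.Adj (l.get ⟨i, by omega⟩) (l.get ⟨i + 1, h⟩)
    else H.Adj (l.get ⟨i + 1, h⟩) (l.get ⟨i, by omega⟩)

/-- A vertex is of type IN if it has an in-neighbor. -/
def TypeIN (G : Dgraph V) (v : V) : Prop := ∃ u, G.Adj u v

/-- A vertex is of type OUT if it has an out-neighbor. -/
def TypeOUT (G : Dgraph V) (v : V) : Prop := ∃ u, G.Adj v u

/-- A vertex is of type SYM if it is of type IN and of type OUT. -/
def TypeSYM (G : Dgraph V) (v : V) : Prop := TypeIN G v ∧ TypeOUT G v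

/-- The zigzag condition for the vertex `v`. -/
def Zigzag (G : Dgraph V) (H : Dgraph X) (v : V) (l : List X) : Prop :=
  (TypeIN G v → INCompatible H l) ∧ (TypeOUT G v → OUTCompatible H l)

/-- A recoloring sequence: a nonempty sequence of homomorphisms in which
consecutive homomorphisms differ on exactly one vertex. -/
def IsRecolSeq (G : Dgraph V) (H : Dgraph X) (σs : List (V → X)) : Prop :=
  σs ≠ [] ∧ (∀ σ ∈ σs, IsHom G H σ) ∧ σs.Chain' fun σ σ' => ∃! u, σ u ≠ σ' u

/-- The monochromatic neighborhood property: whenever a vertex changes its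
color, all of its neighbors (in the underlying undirected graph) have one
common color. -/
def MonoNbhd (G : Dgraph V) (σs : List (V → X)) : Prop :=
  σs.Chain' fun σ σ' => ∀ v, σ v ≠ σ' v → ∃ h, ∀ w, G.UAdj v w → σ w = h

/-- `VWalk G v σs S`: `S` is the vertex walk `S(v)` of the recoloring sequence
`σs`; each color change of `v` from `a` to `b`, while all neighbors of `v` are
colored `h`, contributes the two edges `(a h)(h b)`. -/
inductive VWalk (G : Dgraph V) (v : V) : List (V → X) → List X → Prop
  | single (σ : V → X) : VWalk G v [σ] [σ v]
  | stay {σ σ' : V → X} {rest : List (V → X)} {l : List X} :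
      σ v = σ' v → VWalk G v (σ' :: rest) l → VWalk G v (σ :: σ' :: rest) l
  | move {σ σ' : V → X} {rest : List (V → X)} {l : List X} (h : X) :
      σ v ≠ σ' v → (∀ w, G.UAdj v w → σ w = h) →
      VWalk G v (σ' :: rest) l → VWalk G v (σ :: σ' :: rest) (σ v :: h :: l)

/-- `H`-realizability of a walk `Q` via recoloring sequences satisfying the
monochromatic neighborhood property: `Q = S(q)` in `π(H)`. -/
def MRealizable (G : Dgraph V) (H : Dgraph X) (α β : V → X) (q : V) (Q : List X) : Prop :=
  ∃ (σs : List (V → X)) (Sq : List X),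
    IsRecolSeq G H σs ∧ σs.head? = some α ∧ σs.getLast? = some β ∧
    MonoNbhd G σs ∧ VWalk G q σs Sq ∧ PiEq Sq Q

/-- Orientation compatibility of a walk `Q`: every generated vertex walk
satisfies the zigzag condition. -/
def OrientCompatible (G : Dgraph V) (H : Dgraph X) (α β : V → X) (q : V) (Q : List X) : Prop :=
  ∀ (v : V) (Wl : List V), IsWalk G q v Wl →
    ∀ S : List X, IsReduced S → PiEq (conj α β Wl Q) S → Zigzag G H v S

/-- Hom₁-adjacency: the homomorphisms differ on exactly one vertex and, for
every arc `x → y` of `G`, both `φ x → ψ y` and `ψ x → φ y` are arcs of `H`. -/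
def Hom1Adj (G : Dgraph V) (H : Dgraph X) (φ ψ : V → X) : Prop :=
  (∃! u, φ u ≠ ψ u) ∧ ∀ ⦃x y⦄, G.Adj x y → H.Adj (φ x) (ψ y) ∧ H.Adj (ψ x) (φ y)

/-- A recoloring sequence in the Hom₁ sense (digraphs). -/
def Hom1Seq (G : Dgraph V) (H : Dgraph X) (σs : List (V → X)) : Prop :=
  σs ≠ [] ∧ (∀ σ ∈ σs, IsHom G H σ) ∧ σs.Chain' (Hom1Adj G H)

/-- A recoloring sequence in which each step recolors exactly one vertex to an
adjacent color (the Hom₁ sense for reflexive undirected graphs). -/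
def AdjRecolSeq (G : Dgraph V) (H : Dgraph X) (σs : List (V → X)) : Prop :=
  σs ≠ [] ∧ (∀ σ ∈ σs, IsHom G H σ) ∧
  σs.Chain' fun σ σ' => (∃! u, σ u ≠ σ' u) ∧ ∀ u, σ u ≠ σ' u → H.Adj (σ u) (σ' u)

/-- The push-or-pull property: whenever a vertex changes its color from `a` to
`b`, every neighbor of that vertex has color `a` or `b`. -/
def PushOrPull (G : Dgraph V) (σs : List (V → X)) : Prop :=
  σs.Chain' fun σ σ' => ∀ u, σ u ≠ σ' u → ∀ w, G.UAdj u w → σ w = σ u ∨ σ w = σ' u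

/-- The walk of successive colors of `v` along a recoloring sequence. -/
def colorWalk (σs : List (V → X)) (v : V) : List X := σs.map fun σ => σ v

/-- `H`-realizability via recoloring sequences (reflexive undirected Hom₁
sense) satisfying the push-or-pull property. -/
def PRealizable (G : Dgraph V) (H : Dgraph X) (α β : V → X) (q : V) (Q : List X) : Prop :=
  ∃ σs : List (V → X), AdjRecolSeq G H σs ∧ σs.head? = some α ∧ σs.getLast? = some β ∧
    PushOrPull G σs ∧ PiEq (colorWalk σs q) Q

/-- `H`-realizability via Hom₁ recoloring sequences of digraphs satisfying the
push-or-pull property. -/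
def DRealizable (G : Dgraph V) (H : Dgraph X) (α β : V → X) (q : V) (Q : List X) : Prop :=
  ∃ σs : List (V → X), Hom1Seq G H σs ∧ σs.head? = some α ∧ σs.getLast? = some β ∧
    PushOrPull G σs ∧ PiEq (colorWalk σs q) Q

/-- `H` contains no 4-cycle of algebraic girth 0 as a subgraph (neither of the
two orientations of the 4-cycle with two forward and two backward arcs). -/
def NoZeroGirthC4 (H : Dgraph X) : Prop :=
  ∀ a b c d : X, a ≠ b → a ≠ c → a ≠ d → b ≠ c → b ≠ d → c ≠ d →
    ¬(H.Adj a b ∧ H.Adj b d ∧ H.Adj a c ∧ H.Adj c d) ∧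
    ¬(H.Adj a b ∧ H.Adj d b ∧ H.Adj a c ∧ H.Adj d c)

/-- `H` contains no triangle of algebraic girth 1 as a subgraph. -/
def NoOneGirthTriangle (H : Dgraph X) : Prop :=
  ∀ x y z : X, x ≠ y → y ≠ z → x ≠ z → ¬(H.Adj x y ∧ H.Adj y z ∧ H.Adj x z)

/-- A path in the reconfiguration graph `R_H(G)` from `α` to `β`. -/
def IsRPath (G : Dgraph V) (H : Dgraph X) (α β : V → X) (L : List (V → X)) : Prop :=
  L ≠ [] ∧ L.head? = some α ∧ L.getLast? = some β ∧
  (∀ σ ∈ L, IsHom G H σ) ∧ L.Chain' fun φ ψ => ∃! u, φ u ≠ ψ u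

/-- A path in the graph `Hom₁(G, H)` from `α` to `β`. -/
def IsHom1Path (G : Dgraph V) (H : Dgraph X) (α β : V → X) (L : List (V → X)) : Prop :=
  L ≠ [] ∧ L.head? = some α ∧ L.getLast? = some β ∧
  (∀ σ ∈ L, IsHom G H σ) ∧ L.Chain' (Hom1Adj G H)

/-- The set of reduced walks `Q` from `α q` to `β q` that generate symmetric
vertex walks on `V'` with the system of walks `Wf`. -/
def SymGenSet (H : Dgraph X) (α β : V → X) (q : V)
    (V' : Set V) (Wf : V → List V) : Set (List X) :=
  {Q | IsWalk H (α q) (β q) Q ∧ IsReduced Q ∧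
    ∀ v ∈ V', ∀ S : List X, IsReduced S → PiEq (conj α β (Wf v) Q) S → IsSymWalk H S}

/-- The set of orientation-compatible walks for `q` and the system `Uf`. -/
def OCSet (G : Dgraph V) (H : Dgraph X) (α β : V → X) (q : V)
    (Uf : V → List V) : Set (List X) :=
  {Q | IsWalk H (α q) (β q) Q ∧ IsReduced Q ∧ Even (wlen Q) ∧
    ∀ (v : V) (S : List X), IsReduced S → PiEq (conj α β (Uf v) Q) S → Zigzag G H v S}

/-- The set `Π_q` of walks from `α q` to `β q` that are `H`-realizable via
recoloring sequences satisfying the monochromatic neighborhood property. -/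
def MRealSet (G : Dgraph V) (H : Dgraph X) (α β : V → X) (q : V) : Set (List X) :=
  {Q | IsWalk H (α q) (β q) Q ∧ IsReduced Q ∧ MRealizable G H α β q Q}

/-- The set of walks from `α q` to `β q` that are `H`-realizable via
recoloring sequences satisfying the push-or-pull property. -/
def PRealSet (G : Dgraph V) (H : Dgraph X) (α β : V → X) (q : V) : Set (List X) :=
  {Q | IsWalk H (α q) (β q) Q ∧ IsReduced Q ∧ PRealizable G H α β q Q}

/-- Ceiling division on natural numbers. -/
def cdiv (a b : ℕ) : ℕ := (a + b - 1) / b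

end HRecoloring

namespace HRecoloring

variable {V X : Type}

section Holonomy

/-- The image of the edge `x y` of the complete graph on `X` in a free group, chosen so that
opposite edges have inverse images and loops are trivial. -/
def edgeVal (x y : X) : FreeGroup (X × X) := FreeGroup.of (x, y) * (FreeGroup.of (y, x))⁻¹

@[simp] theorem edgeVal_self (x : X) : edgeVal x x = 1 := by simp [edgeVal]

theorem edgeVal_inv (x y : X) : (edgeVal x y)⁻¹ = edgeVal y x := by simp [edgeVal]

@[simp] theorem edgeVal_mul_swap (x y : X) : edgeVal x y * edgeVal y x = 1 := by simp [edgeVal]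

/-- The product of the images of the edges of a walk. -/
def walkVal : List X → FreeGroup (X × X)
  | [] => 1
  | [_] => 1
  | x :: y :: l => edgeVal x y * walkVal (y :: l)

@[simp] theorem walkVal_singleton (x : X) : walkVal [x] = 1 := rfl

@[simp] theorem walkVal_cons_cons (x y : X) (l : List X) :
    walkVal (x :: y :: l) = edgeVal x y * walkVal (y :: l) := rfl

theorem walkVal_append_cons (p : List X) (a : X) (s : List X) :
    walkVal (p ++ a :: s) = walkVal (p ++ [a]) * walkVal (a :: s) := by
  induction p with
  | nil => simp
  | cons x p ih => cases p <;> simp_all [mul_assoc]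

theorem walkVal_reverse (l : List X) : walkVal l.reverse = (walkVal l)⁻¹ := by
  induction l with
  | nil => simp [walkVal]
  | cons x l ih =>
    cases l with
    | nil => simp
    | cons y l =>
      have := walkVal_append_cons l.reverse y [x]
      simp only [List.reverse_cons, List.append_assoc, List.singleton_append] at ih ⊢
      simp [this, ih, edgeVal_inv]

/-- The list `l` starts at `a` and ends at `b`. -/
def Joins (a b : X) (l : List X) : Prop := l.head? = some a ∧ l.getLast? = some b

theorem IsWalk.joins {G : Dgraph V} {a b : V} {l : List V} (h : IsWalk G a b l) : Joins a b l :=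
  ⟨h.2.1, h.2.2.1⟩

theorem joins_singleton (a : X) : Joins a a [a] := by simp [Joins]

theorem Joins.cons {a b c : X} {l : List X} (h : Joins b c l) : Joins a c (a :: l) := by
  obtain ⟨h₁, h₂⟩ := h
  cases l with
  | nil => simp at h₁
  | cons x l => exact ⟨rfl, by simpa [List.getLast?_cons_cons] using h₂⟩

theorem Joins.exists_cons {a b : X} {l : List X} (h : Joins a b l) : ∃ t, l = a :: t := by
  cases l <;> simp_all [Joins]

theorem Joins.exists_concat {a b : X} {l : List X} (h : Joins a b l) : ∃ t, l = t ++ [b] := by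
  obtain ⟨t, ht⟩ := List.getLast?_eq_some_iff.1 h.2
  exact ⟨t, ht⟩

theorem Joins.reverse {a b : X} {l : List X} (h : Joins a b l) : Joins b a l.reverse := by
  simpa [Joins, and_comm] using h

theorem Joins.map {a b : V} {l : List V} (h : Joins a b l) (f : V → X) :
    Joins (f a) (f b) (l.map f) := by
  simp [Joins, h.1, h.2]

theorem Joins.wcomp {a b c : X} {l m : List X} (h : Joins a b l) (h' : Joins b c m) :
    Joins a c (wcomp l m) := by
  obtain ⟨t, rfl⟩ := h'.exists_cons
  obtain ⟨p, rfl⟩ := h.exists_concat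
  constructor
  · have := h.1
    cases p <;> simp_all [HRecoloring.wcomp]
  · have := h'.2
    simpa [HRecoloring.wcomp, List.getLast?_append] using this

theorem Joins.walkVal_wcomp {a b c : X} {l m : List X} (h : Joins a b l) (h' : Joins b c m) :
    walkVal (HRecoloring.wcomp l m) = walkVal l * walkVal m := by
  obtain ⟨t, rfl⟩ := h'.exists_cons
  obtain ⟨p, rfl⟩ := h.exists_concat
  simpa [HRecoloring.wcomp] using walkVal_append_cons p b t

theorem RStep.walkVal_eq {l l' : List X} (h : RStep l l') : walkVal l = walkVal l' := by
  obtain ⟨p, s, x, y, rfl, rfl⟩ | ⟨p, s, x, rfl, rfl⟩ := h <;>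
  · simp only [List.append_assoc, List.cons_append, List.nil_append]
    rw [walkVal_append_cons, walkVal_append_cons p x s]
    simp [← mul_assoc]

theorem RStep.joins_iff {l l' : List X} (h : RStep l l') (a b : X) :
    Joins a b l ↔ Joins a b l' := by
  obtain ⟨p, s, x, y, rfl, rfl⟩ | ⟨p, s, x, rfl, rfl⟩ := h <;>
  · simp only [Joins, List.append_assoc, List.getLast?_append, List.head?_append]
    simp [List.getLast?_cons_cons]

theorem RStep.length_lt {l l' : List X} (h : RStep l l') : l'.length < l.length := by
  obtain ⟨p, s, x, y, rfl, rfl⟩ | ⟨p, s, x, rfl, rfl⟩ := h <;> simp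

theorem PiEq.walkVal_eq {l l' : List X} (h : PiEq l l') : walkVal l = walkVal l' := by
  induction h with
  | rel _ _ h => exact h.walkVal_eq
  | refl => rfl
  | symm _ _ _ ih => exact ih.symm
  | trans _ _ _ _ _ ih₁ ih₂ => exact ih₁.trans ih₂

theorem PiEq.joins_iff {l l' : List X} (h : PiEq l l') (a b : X) :
    Joins a b l ↔ Joins a b l' := by
  induction h with
  | rel _ _ h => exact h.joins_iff a b
  | refl => rfl
  | symm _ _ _ ih => exact ih.symm
  | trans _ _ _ _ _ ih₁ ih₂ => exact ih₁.trans ih₂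

/-- Any property of walks preserved by reduction passes to some reduced form. -/
theorem exists_isReduced_of_stable {p : List X → Prop} (hp : ∀ l l', RStep l l' → p l → p l')
    (l : List X) (hl : p l) : ∃ S, IsReduced S ∧ PiEq l S ∧ p S := by
  induction hn : l.length using Nat.strong_induction_on generalizing l with
  | _ n ih =>
    by_cases hred : IsReduced l
    · exact ⟨l, hred, Relation.EqvGen.refl _, hl⟩
    · simp only [IsReduced, not_forall, not_not] at hred
      obtain ⟨l', h⟩ := hred
      obtain ⟨S, hS, hlS, hpS⟩ := ih _ (hn ▸ h.length_lt) l' (hp _ _ h hl) rfl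
      exact ⟨S, hS, (Relation.EqvGen.rel _ _ h).trans _ _ _ hlS, hpS⟩

end Holonomy

section Reduced

/-- A recursive form of `IsReduced`. -/
def NoBack : List X → Prop
  | x :: y :: l => x ≠ y ∧ (∀ z ∈ l.head?, x ≠ z) ∧ NoBack (y :: l)
  | _ => True

@[simp] theorem noBack_nil : NoBack ([] : List X) := trivial

@[simp] theorem noBack_singleton (x : X) : NoBack [x] := trivial

@[simp] theorem noBack_cons_cons (x y : X) (l : List X) :
    NoBack (x :: y :: l) ↔ x ≠ y ∧ (∀ z ∈ l.head?, x ≠ z) ∧ NoBack (y :: l) := Iff.rfl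

theorem NoBack.of_cons {x : X} {l : List X} (h : NoBack (x :: l)) : NoBack l := by
  cases l with
  | nil => trivial
  | cons y l => exact h.2.2

theorem NoBack.of_append_right {p l : List X} (h : NoBack (p ++ l)) : NoBack l := by
  induction p with
  | nil => exact h
  | cons x p ih => exact ih h.of_cons

theorem isReduced_iff_noBack {l : List X} : IsReduced l ↔ NoBack l := by
  constructor
  · intro h
    induction l with
    | nil => trivial
    | cons x l ih =>
      have hl : NoBack l := ih fun l' h' => h (x :: l') <| by
        obtain ⟨p, s, y, z, rfl, rfl⟩ | ⟨p, s, y, rfl, rfl⟩ := h'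
        · exact .inl ⟨x :: p, s, y, z, rfl, rfl⟩
        · exact .inr ⟨x :: p, s, y, rfl, rfl⟩
      cases l with
      | nil => trivial
      | cons y l =>
        refine ⟨?_, ?_, hl⟩
        · rintro rfl
          exact h (x :: l) (.inr ⟨[], l, x, rfl, rfl⟩)
        · rintro z hz rfl
          cases l with
          | nil => simp at hz
          | cons w l =>
            obtain rfl : w = x := by simpa using hz
            exact h (w :: l) (.inl ⟨[], l, w, y, rfl, rfl⟩)
  · rintro h l' (⟨p, s, x, y, rfl, rfl⟩ | ⟨p, s, x, rfl, rfl⟩) <;>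
    · rw [List.append_assoc] at h
      simpa using h.of_append_right

theorem noBack_append_cons (p : List X) (a : X) (s : List X) :
    NoBack (p ++ a :: s) ↔
      NoBack (p ++ [a]) ∧ NoBack (a :: s) ∧ ∀ x ∈ p.getLast?, ∀ y ∈ s.head?, x ≠ y := by
  induction p with
  | nil => simp
  | cons x p ih =>
    cases p with
    | nil => simp; tauto
    | cons y p =>
      have e : (p ++ a :: s).head? = (p ++ [a]).head? := by cases p <;> simp
      simp only [List.cons_append, noBack_cons_cons, List.getLast?_cons_cons, e] at ih ⊢
      tauto

theorem NoBack.of_append_left {p l : List X} (h : NoBack (p ++ l)) : NoBack p := by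
  cases l with
  | nil => simpa using h
  | cons a s =>
    obtain rfl | ⟨q, b, rfl⟩ := p.eq_nil_or_concat'
    · trivial
    · rw [List.append_assoc, List.singleton_append] at h
      exact ((noBack_append_cons q b _).1 h).1

theorem NoBack.reverse {l : List X} (h : NoBack l) : NoBack l.reverse := by
  induction l with
  | nil => trivial
  | cons x l ih =>
    cases l with
    | nil => trivial
    | cons y l =>
      have := ih h.2.2
      simp only [List.reverse_cons, List.append_assoc, List.singleton_append] at this ⊢
      refine (noBack_append_cons _ _ _).2 ⟨this, ?_, ?_⟩
      · simpa using h.1.symm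
      · simp only [List.getLast?_reverse, List.head?_cons, Option.mem_def, Option.some.injEq]
        rintro z hz _ rfl
        exact (h.2.1 z hz).symm

/-- The word in the free group spelled by a walk. -/
def walkWord : List X → List ((X × X) × Bool)
  | x :: y :: l => ((x, y), true) :: ((y, x), false) :: walkWord (y :: l)
  | _ => []

theorem mk_walkWord (l : List X) : FreeGroup.mk (walkWord l) = walkVal l := by
  induction l with
  | nil => rfl
  | cons x l ih =>
    cases l with
    | nil => rfl
    | cons y l =>
      rw [walkVal_cons_cons, ← ih, edgeVal]
      rfl

theorem NoBack.isReduced_walkWord {l : List X} (h : NoBack l) :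
    FreeGroup.IsReduced (walkWord l) := by
  induction l with
  | nil => exact .nil
  | cons x l ih =>
    cases l with
    | nil => exact .nil
    | cons y l =>
      rw [walkWord, FreeGroup.isReduced_cons_cons]
      refine ⟨fun e => absurd (congrArg Prod.fst e) h.1, ?_⟩
      cases l with
      | nil => exact .singleton
      | cons z l =>
        have := ih h.2.2
        rw [walkWord] at this ⊢
        rw [FreeGroup.isReduced_cons_cons]
        exact ⟨fun e => absurd (congrArg Prod.snd e) (h.2.1 z rfl), this⟩

theorem eq_of_walkWord_eq {a b c : X} {l m : List X} (hl : Joins a b l) (hm : Joins a c m)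
    (h : walkWord l = walkWord m) : l = m := by
  induction l generalizing m a with
  | nil => simp [Joins] at hl
  | cons x l ih =>
    obtain rfl : x = a := by simpa using hl.1
    obtain ⟨m, rfl⟩ := hm.exists_cons
    cases l with
    | nil => cases m <;> simp_all [walkWord]
    | cons y l =>
      cases m with
      | nil => simp [walkWord] at h
      | cons z m =>
        simp only [walkWord, List.cons.injEq, Prod.mk.injEq, and_true, true_and] at h
        obtain ⟨rfl, -, h⟩ := h
        rw [ih (a := y) ⟨rfl, by simpa [Joins] using hl.2⟩ ⟨rfl, by simpa [Joins] using hm.2⟩ h]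

/-- Reduced walks with the same start are determined by their values. -/
theorem NoBack.eq_of_walkVal_eq {a b c : X} {l m : List X} (hl : NoBack l) (hm : NoBack m)
    (hal : Joins a b l) (ham : Joins a c m) (h : walkVal l = walkVal m) : l = m := by
  refine eq_of_walkWord_eq hal ham ?_
  rw [← mk_walkWord, ← mk_walkWord] at h
  classical
  have := congrArg FreeGroup.toWord h
  rwa [FreeGroup.toWord_mk, FreeGroup.toWord_mk, hl.isReduced_walkWord.reduce_eq,
    hm.isReduced_walkWord.reduce_eq] at this

theorem piEq_of_walkVal_eq {a b c : X} {l m : List X} (hl : Joins a b l) (hm : Joins a c m)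
    (h : walkVal l = walkVal m) : PiEq l m := by
  obtain ⟨S, hS, hlS, -⟩ := exists_isReduced_of_stable (p := fun _ => True) (by simp) l trivial
  obtain ⟨T, hT, hmT, -⟩ := exists_isReduced_of_stable (p := fun _ => True) (by simp) m trivial
  obtain rfl : S = T := (isReduced_iff_noBack.1 hS).eq_of_walkVal_eq (isReduced_iff_noBack.1 hT)
    ((hlS.joins_iff a b).1 hl) ((hmT.joins_iff a c).1 hm)
    (by rw [← hlS.walkVal_eq, h, hmT.walkVal_eq])
  exact hlS.trans _ _ _ (hmT.symm _ _)

/-- Appending an edge to a reduced walk destroys at most its last edge. -/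
theorem NoBack.exists_mul_edge {a b : X} {l : List X} (hl : NoBack l) (hj : Joins a b l) (y : X) :
    ∃ m, NoBack m ∧ Joins a y m ∧ l.dropLast <+: m ∧ walkVal m = walkVal l * edgeVal b y := by
  obtain ⟨p, rfl⟩ := hj.exists_concat
  by_cases hby : b = y
  · subst hby
    exact ⟨_, hl, hj, by simp, by simp⟩
  by_cases hp : ∃ r, p = r ++ [y]
  · obtain ⟨r, rfl⟩ := hp
    refine ⟨r ++ [y], hl.of_append_left, ⟨?_, by simp⟩, by simp, ?_⟩
    · have := hj.1
      cases r <;> simp_all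
    · have := walkVal_append_cons r y [b]
      simp only [List.append_assoc, List.singleton_append]
      rw [this]
      simp [mul_assoc]
  · refine ⟨p ++ b :: [y], ?_, ⟨?_, ?_⟩, by simp, ?_⟩
    · rw [noBack_append_cons]
      refine ⟨hl, by simpa using hby, ?_⟩
      simp only [List.head?_cons, Option.mem_def, Option.some.injEq]
      rintro x hx _ rfl rfl
      exact hp (List.getLast?_eq_some_iff.1 hx)
    · have := hj.1
      cases p <;> simp_all
    · simp
    · rw [walkVal_append_cons]
      simp

/-- Appending a walk with `k` edges to a reduced walk destroys at most its last `k` edges. -/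
theorem NoBack.exists_mul {a b c : X} {l Z : List X} (hl : NoBack l) (hj : Joins a b l)
    (hZ : Joins b c Z) :
    ∃ m, NoBack m ∧ Joins a c m ∧ l.take (l.length - wlen Z) <+: m ∧
      walkVal m = walkVal l * walkVal Z := by
  induction Z generalizing l b with
  | nil => simp [Joins] at hZ
  | cons x Z ih =>
    obtain rfl : x = b := by simpa using hZ.1
    cases Z with
    | nil =>
      obtain rfl : x = c := by simpa using hZ.2
      exact ⟨l, hl, hj, by simp [wlen], by simp⟩
    | cons y Z =>
      obtain ⟨l₁, h₁, j₁, p₁, e₁⟩ := hl.exists_mul_edge hj y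
      obtain ⟨m, h₂, j₂, p₂, e₂⟩ := ih h₁ j₁ ⟨rfl, by simpa using hZ.2⟩
      refine ⟨m, h₂, j₂, List.IsPrefix.trans ?_ p₂, by rw [e₂, e₁]; simp [mul_assoc]⟩
      have hlen := p₁.length_le
      rw [List.prefix_take_iff]
      simp only [List.length_dropLast, wlen, List.length_cons, List.length_take] at hlen ⊢
      refine ⟨List.IsPrefix.trans ?_ p₁, by omega⟩
      rw [List.dropLast_eq_take]
      exact List.take_prefix_take_left (by omega)

end Reduced

end HRecoloring

namespace HRecoloring

variable {V X : Type}

section Moves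

theorem isSymWalk_iff {H : Dgraph X} {l : List X} :
    IsSymWalk H l ↔ l.IsChain fun a b => H.Adj a b ∧ H.Adj b a := Iff.rfl

/-- A push-or-pull move: exactly one vertex `u` changes its color, and all neighbors of `u` have
the old or the new color of `u`. -/
def Move (G : Dgraph V) (σ σ' : V → X) : Prop :=
  (∃! u, σ u ≠ σ' u) ∧ ∀ u, σ u ≠ σ' u → ∀ w, G.UAdj u w → σ w = σ u ∨ σ w = σ' u

/-- A push-or-pull move along a symmetric arc of `H`. -/
def SymMove (G : Dgraph V) (H : Dgraph X) (σ σ' : V → X) : Prop :=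
  Move G σ σ' ∧ ∀ u, σ u ≠ σ' u → H.Adj (σ u) (σ' u) ∧ H.Adj (σ' u) (σ u)

/-- `Moves r β α g`: there is an `r`-sequence from `α` to `β` along which the color walk of
every vertex `v` has value `g v`. -/
inductive Moves (r : (V → X) → (V → X) → Prop) (β : V → X) :
    (V → X) → (V → FreeGroup (X × X)) → Prop
  | refl : Moves r β β fun _ => 1
  | step {σ σ' : V → X} {g : V → FreeGroup (X × X)} :
      r σ σ' → Moves r β σ' g → Moves r β σ fun v => edgeVal (σ v) (σ' v) * g v

theorem Dgraph.UAdj.symm {G : Dgraph V} {u v : V} (h : G.UAdj u v) : G.UAdj v u := Or.symm h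

variable {G : Dgraph V} {H : Dgraph X} {α β : V → X} {g : V → FreeGroup (X × X)}

theorem moves_of_isChain {r : (V → X) → (V → X) → Prop} {σs : List (V → X)}
    (hσs : Joins α β σs) (h : σs.IsChain r) :
    Moves r β α fun v => walkVal (colorWalk σs v) := by
  induction σs generalizing α with
  | nil => simp [Joins] at hσs
  | cons σ σs ih =>
    obtain rfl : σ = α := by simpa using hσs.1
    cases σs with
    | nil =>
      obtain rfl : σ = β := by simpa using hσs.2
      exact .refl
    | cons σ' σs =>
      rw [List.isChain_cons_cons] at h
      exact .step h.1 (ih ⟨rfl, by simpa using hσs.2⟩ h.2)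

theorem Moves.exists_isChain {r : (V → X) → (V → X) → Prop} (h : Moves r β α g) :
    ∃ σs : List (V → X), Joins α β σs ∧ σs.IsChain r ∧ ∀ v, walkVal (colorWalk σs v) = g v := by
  induction h with
  | refl => exact ⟨[β], joins_singleton _, by simp, fun v => rfl⟩
  | @step σ σ' g hr _ ih =>
    obtain ⟨σs, hj, hc, hg⟩ := ih
    obtain ⟨t, rfl⟩ := hj.exists_cons
    refine ⟨σ :: σ' :: t, hj.cons, by simp [hr, hc], fun v => ?_⟩
    simp [← hg, colorWalk]

theorem Move.square {σ σ' : V → X} (h : Move G σ σ') {u w : V} (huw : G.UAdj u w) :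
    edgeVal (σ u) (σ' u) * edgeVal (σ' u) (σ' w) =
      edgeVal (σ u) (σ w) * edgeVal (σ w) (σ' w) := by
  by_cases hu : σ u = σ' u <;> by_cases hw : σ w = σ' w
  · simp [hu, hw]
  · rcases h.2 w hw u huw.symm with e | e
    · simp [← hu, e]
    · simp [← hu, e]
  · rcases h.2 u hu w huw with e | e
    · simp [← hw, e]
    · simp [← hw, e]
  · obtain rfl := h.1.unique hu hw
    simp

theorem Moves.edge (h : Moves (Move G) β α g) {u w : V} (huw : G.UAdj u w) :
    g u * edgeVal (β u) (β w) = edgeVal (α u) (α w) * g w := by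
  induction h with
  | refl => simp
  | step hr _ ih => rw [mul_assoc, ih, ← mul_assoc, ← mul_assoc, hr.square huw]

theorem Moves.walk (h : Moves (Move G) β α g) {u v : V} {W : List V} (hW : Joins u v W)
    (hc : W.IsChain G.UAdj) :
    g u * walkVal (W.map β) = walkVal (W.map α) * g v := by
  induction W generalizing u with
  | nil => simp [Joins] at hW
  | cons x W ih =>
    obtain rfl : x = u := by simpa using hW.1
    cases W with
    | nil =>
      obtain rfl : x = v := by simpa using hW.2
      simp
    | cons y W =>
      rw [List.isChain_cons_cons] at hc
      have := ih ⟨rfl, by simpa using hW.2⟩ hc.2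
      simp only [List.map_cons, walkVal_cons_cons] at this ⊢
      rw [← mul_assoc, h.edge hc.1, mul_assoc, this, mul_assoc]

/-- Vertices of a tight set, in which every vertex has two neighbors such that the three colors
are distinct, never move. -/
theorem Moves.eq_one_of_tight (h : Moves (Move G) β α g) {C : Set V}
    (hC : ∀ u ∈ C, ∃ w ∈ C, ∃ w' ∈ C, G.UAdj u w ∧ G.UAdj u w' ∧
      α u ≠ α w ∧ α u ≠ α w' ∧ α w ≠ α w') : ∀ u ∈ C, g u = 1 := by
  induction h with
  | refl => simp
  | @step σ σ' g hr _ ih =>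
    have hfix : ∀ u ∈ C, σ u = σ' u := by
      intro u hu
      by_contra hne
      obtain ⟨w, -, w', -, hw, hw', h₁, h₂, h₃⟩ := hC u hu
      have e := (hr.2 u hne w hw).resolve_left h₁.symm
      have e' := (hr.2 u hne w' hw').resolve_left h₂.symm
      exact h₃ (e.trans e'.symm)
    intro u hu
    have hg : g u = 1 := by
      refine ih (fun u hu => ?_) u hu
      obtain ⟨w, hwC, w', hwC', h⟩ := hC u hu
      exact ⟨w, hwC, w', hwC', by rwa [← hfix u hu, ← hfix w hwC, ← hfix w' hwC']⟩
    simp [hg, hfix u hu]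

variable {f : V → List X}

theorem Moves.exists_eq_cons_of_blocked (h : Moves (Move G) β α fun v => walkVal (f v))
    (hf : ∀ v, NoBack (f v)) (hj : ∀ v, Joins (α v) (β v) (f v)) {u w : V} {b : X} {t : List X}
    (hu : f u = α u :: b :: t) (huw : G.UAdj u w) (h₁ : α w ≠ α u) (h₂ : α w ≠ b) :
    ∃ t', f w = α w :: α u :: t' := by
  have hl : NoBack (α w :: f u) := by
    have := hf u
    rw [hu] at this ⊢
    exact ⟨h₁, by simpa using h₂, this⟩
  obtain ⟨m, hm, jm, pm, em⟩ := hl.exists_mul_edge (hj u).cons (β w)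
  have hmw : m = f w := by
    refine hm.eq_of_walkVal_eq (hf w) jm (hj w) ?_
    have := h.edge huw
    rw [em, hu, walkVal_cons_cons, mul_assoc, ← hu, this, ← mul_assoc, edgeVal_mul_swap, one_mul]
  obtain ⟨s, hs⟩ := pm
  rw [hu] at hs
  exact ⟨_, by rw [← hmw, ← hs]; rfl⟩

theorem Moves.exists_movable [Finite V] (h : Moves (Move G) β α fun v => walkVal (f v))
    (hf : ∀ v, NoBack (f v)) (hj : ∀ v, Joins (α v) (β v) (f v)) {u₀ : V} {b₀ : X} {t₀ : List X}
    (h₀ : f u₀ = α u₀ :: b₀ :: t₀) :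
    ∃ u b t, f u = α u :: b :: t ∧ ∀ w, G.UAdj u w → α w = α u ∨ α w = b := by
  by_contra! hno
  have hnext : ∀ u, (∃ b t, f u = α u :: b :: t) → ∃ w, G.UAdj u w ∧ α w ≠ α u ∧
      (∃ t, f w = α w :: α u :: t) ∧ ∀ b t, f u = α u :: b :: t → α w ≠ b := by
    rintro u ⟨b, t, hu⟩
    obtain ⟨w, huw, h₁, h₂⟩ := hno u b t hu
    refine ⟨w, huw, h₁, h.exists_eq_cons_of_blocked hf hj hu huw h₁ h₂, fun b' t' hu' => ?_⟩
    obtain ⟨rfl, -⟩ : b = b' ∧ t = t' := by simpa [hu] using hu'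
    exact h₂
  choose! next hadj hne hhead hskip using hnext
  have hD : ∀ k, ∃ b t, f (next^[k] u₀) = α (next^[k] u₀) :: b :: t := by
    intro k
    induction k with
    | zero => exact ⟨_, _, h₀⟩
    | succ k ih =>
      rw [Function.iterate_succ_apply']
      exact ⟨_, hhead _ ih⟩
  obtain ⟨i, j, hij, heq⟩ : ∃ i j, i < j ∧ next^[i] u₀ = next^[j] u₀ := by
    obtain ⟨i, j, hij, heq⟩ := Finite.exists_ne_map_eq_of_infinite fun k => next^[k] u₀
    rcases lt_or_gt_of_ne hij with hlt | hlt
    · exact ⟨i, j, hlt, heq⟩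
    · exact ⟨j, i, hlt, heq.symm⟩
  have hpred : ∀ k, i ≤ k → ∃ l, i ≤ l ∧ next (next^[l] u₀) = next^[k] u₀ := by
    intro k hk
    rcases hk.eq_or_lt with rfl | hlt
    · exact ⟨j - 1, by omega, by
        rw [heq, ← Function.iterate_succ_apply' next,
          Nat.succ_eq_add_one, Nat.sub_add_cancel (by omega)]⟩
    · exact ⟨k - 1, by omega, by
        rw [← Function.iterate_succ_apply' next,
          Nat.succ_eq_add_one, Nat.sub_add_cancel (by omega)]⟩
  have hone := h.eq_one_of_tight (C := {u | ∃ k, i ≤ k ∧ next^[k] u₀ = u}) (by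
    rintro _ ⟨k, hk, rfl⟩
    obtain ⟨l, hl, hlk⟩ := hpred k hk
    refine ⟨_, ⟨k + 1, by omega, rfl⟩, _, ⟨l, hl, rfl⟩, ?_⟩
    rw [Function.iterate_succ_apply']
    obtain ⟨t, ht⟩ := hhead _ (hD l)
    refine ⟨hadj _ (hD k), ?_, (hne _ (hD k)).symm, ?_, hskip _ (hD k) _ t ?_⟩
    · rw [← hlk]
      exact (hadj _ (hD l)).symm
    · rw [← hlk]
      exact hne _ (hD l)
    · rw [← hlk]
      exact ht) _ ⟨i, le_rfl, rfl⟩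
  obtain ⟨b, t, hbt⟩ := hD i
  have := (hf (next^[i] u₀)).eq_of_walkVal_eq (noBack_singleton (α (next^[i] u₀))) (hj _)
    (joins_singleton _) hone
  simp [hbt] at this

/-- If the reduced color walks of a push-or-pull sequence are symmetric in `H`, then the colors
can be moved along these reduced walks. -/
theorem Moves.symMoves [Fintype V] (h : Moves (Move G) β α fun v => walkVal (f v))
    (hf : ∀ v, NoBack (f v)) (hj : ∀ v, Joins (α v) (β v) (f v)) (hs : ∀ v, IsSymWalk H (f v)) :
    Moves (SymMove G H) β α fun v => walkVal (f v) := by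
  classical
  induction hn : ∑ v, (f v).length using Nat.strong_induction_on generalizing α f with
  | _ n ih =>
    by_cases htriv : ∀ v, f v = [α v]
    · obtain rfl : α = β := funext fun v => by simpa [htriv, Joins] using (hj v)
      simpa [htriv] using Moves.refl (r := SymMove G H) (β := α)
    push Not at htriv
    obtain ⟨u₀, hu₀⟩ := htriv
    obtain ⟨t₀, ht₀⟩ := (hj u₀).exists_cons
    obtain ⟨b₀, t₀, rfl⟩ : ∃ b t, t₀ = b :: t := by
      cases t₀ with
      | nil => exact absurd ht₀ hu₀
      | cons b t => exact ⟨b, t, rfl⟩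
    obtain ⟨u, b, t, hu, hmov⟩ := h.exists_movable hf hj ht₀
    have hred := hf u
    rw [hu] at hred
    have hsym := hs u
    rw [hu, isSymWalk_iff, List.isChain_cons_cons] at hsym
    have huj := hj u
    rw [hu] at huj
    have hother : ∀ v, v ≠ u → Function.update α u b v = α v := fun v hv => by simp [hv]
    have hmove : SymMove G H α (Function.update α u b) := by
      refine ⟨⟨⟨u, by simpa using hred.1, fun v hv => ?_⟩, fun v hv w hw => ?_⟩, fun v hv => ?_⟩
      · by_contra hvu
        exact hv (hother v hvu).symm
      all_goals
        obtain rfl : v = u := by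
          by_contra hvu
          exact hv (hother v hvu).symm
      · simpa using hmov w hw
      · simpa using hsym.1
    have hback : Move G (Function.update α u b) α := by
      refine ⟨⟨u, by simpa using hred.1.symm, fun v hv => ?_⟩, fun v hv w hw => ?_⟩
      · by_contra hvu
        exact hv (hother v hvu)
      · obtain rfl : v = u := by
          by_contra hvu
          exact hv (hother v hvu)
        by_cases hwv : w = v
        · subst hwv
          exact .inl rfl
        · simpa [hwv, or_comm] using hmov w hw
    have key := ih (∑ v, (Function.update f u (b :: t) v).length) (by
      rw [← hn]
      refine Finset.sum_lt_sum (fun v _ => ?_) ⟨u, Finset.mem_univ _, by simp [hu]⟩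
      by_cases hv : v = u
      · subst hv
        simp [hu]
      · simp [hv]) (α := Function.update α u b) (f := Function.update f u (b :: t)) (by
      convert Moves.step hback h using 2 with v
      by_cases hv : v = u
      · subst hv
        simp [hu, ← mul_assoc]
      · simp [hv]) (fun v => by
      by_cases hv : v = u
      · subst hv
        simpa using hred.2.2
      · simpa [hv] using hf v) (fun v => by
      by_cases hv : v = u
      · subst hv
        simpa [Joins] using huj.2
      · simpa [hv] using hj v) (fun v => by
      by_cases hv : v = u
      · subst hv
        simpa [isSymWalk_iff] using hsym.2
      · simpa [hv] using hs v) rfl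
    convert Moves.step hmove key using 2 with v
    by_cases hv : v = u
    · subst hv
      simp [hu]
    · simp [hv]

end Moves

end HRecoloring

namespace HRecoloring

variable {V X : Type}

section Symmetric

/-- `γ` is the value of a symmetric walk from `a` to `b`. -/
def SymVal (H : Dgraph X) (a b : X) (γ : FreeGroup (X × X)) : Prop :=
  ∃ S, Joins a b S ∧ IsSymWalk H S ∧ walkVal S = γ

variable {H : Dgraph X} {a b c : X} {γ δ : FreeGroup (X × X)}

theorem isSymWalk_append_cons (p : List X) (a : X) (s : List X) :
    IsSymWalk H (p ++ a :: s) ↔ IsSymWalk H (p ++ [a]) ∧ IsSymWalk H (a :: s) :=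
  List.isChain_split

theorem SymVal.mul (h : SymVal H a b γ) (h' : SymVal H b c δ) : SymVal H a c (γ * δ) := by
  obtain ⟨S, hj, hs, rfl⟩ := h
  obtain ⟨T, hj', hs', rfl⟩ := h'
  refine ⟨_, hj.wcomp hj', ?_, hj.walkVal_wcomp hj'⟩
  obtain ⟨t, rfl⟩ := hj'.exists_cons
  obtain ⟨p, rfl⟩ := hj.exists_concat
  simpa [wcomp] using (isSymWalk_append_cons p b t).2 ⟨hs, hs'⟩

theorem SymVal.inv (h : SymVal H a b γ) : SymVal H b a γ⁻¹ := by
  obtain ⟨S, hj, hs, rfl⟩ := h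
  refine ⟨_, hj.reverse, ?_, walkVal_reverse S⟩
  simpa [isSymWalk_iff, List.isChain_reverse, and_comm] using hs

theorem SymVal.pow (h : SymVal H a a γ) (n : ℕ) : SymVal H a a (γ ^ n) := by
  induction n with
  | zero => exact ⟨[a], joins_singleton a, by simp [isSymWalk_iff], by simp⟩
  | succ n ih => exact pow_succ γ n ▸ ih.mul h

theorem SymVal.zpow (h : SymVal H a a γ) (n : ℤ) : SymVal H a a (γ ^ n) := by
  cases n with
  | ofNat n => simpa using h.pow n
  | negSucc n => simpa using (h.pow (n + 1)).inv

theorem RStep.isSymWalk {l l' : List X} (h : RStep l l') (hl : IsSymWalk H l) :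
    IsSymWalk H l' := by
  obtain ⟨p, s, x, y, rfl, rfl⟩ | ⟨p, s, x, rfl, rfl⟩ := h <;>
  · simp only [List.append_assoc, List.cons_append, List.nil_append] at hl ⊢
    rw [isSymWalk_append_cons] at hl ⊢
    exact ⟨hl.1, by have := hl.2; simp only [isSymWalk_iff,
      List.isChain_cons_cons] at this ⊢; tauto⟩

theorem SymVal.exists_noBack (h : SymVal H a b γ) :
    ∃ S, NoBack S ∧ Joins a b S ∧ IsSymWalk H S ∧ walkVal S = γ := by
  obtain ⟨S, hj, hs, rfl⟩ := h
  obtain ⟨T, hT, hST, hs'⟩ :=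
    exists_isReduced_of_stable (p := IsSymWalk H) (fun _ _ h => h.isSymWalk) S hs
  exact ⟨T, isReduced_iff_noBack.1 hT, (hST.joins_iff a b).1 hj, hs', hST.walkVal_eq.symm⟩

end Symmetric

section ReducedLoop

/-- `γ` is the value of a reduced loop at `a` of the form `b · T · b⁻¹` where `T` is cyclically
reduced with `D` edges; here `T` is `h :: t ++ [h]`. -/
def LoopVal (a : X) (D : ℕ) (γ : FreeGroup (X × X)) : Prop :=
  ∃ (b : List X) (h : X) (t : List X), NoBack (b ++ [h]) ∧ Joins a h (b ++ [h]) ∧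
    NoBack (h :: (t ++ [h])) ∧ t.length + 1 = D ∧
    (∀ x ∈ t.getLast?, ∀ y ∈ t.head?, x ≠ y) ∧
    (∀ x ∈ b.getLast?, ∀ y ∈ t.head?, x ≠ y) ∧
    (∀ x ∈ b.getLast?, ∀ y ∈ t.getLast?, x ≠ y) ∧
    γ = walkVal (b ++ [h]) * walkVal (h :: (t ++ [h])) * (walkVal (b ++ [h]))⁻¹

variable {a : X} {D : ℕ} {γ : FreeGroup (X × X)}

theorem LoopVal.inv (h : LoopVal a D γ) : LoopVal a D γ⁻¹ := by
  obtain ⟨b, h, t, hb, hj, ht, hD, h₁, h₂, h₃, rfl⟩ := h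
  have e : (h :: (t ++ [h])).reverse = h :: (t.reverse ++ [h]) := by simp
  refine ⟨b, h, t.reverse, hb, hj, e ▸ ht.reverse, by simpa, ?_, by simpa, by simpa, ?_⟩
  · simpa using fun x hx y hy => (h₁ y hy x hx).symm
  · rw [← e, walkVal_reverse]
    group

theorem LoopVal.rotate {h x : X} {t : List X} (ht : NoBack (h :: (x :: t ++ [h])))
    (h₁ : ∀ y ∈ (x :: t).getLast?, y ≠ x) :
    LoopVal x (t.length + 2) (edgeVal x h * walkVal (h :: (x :: t ++ [h])) * edgeVal h x) := by
  have hne : t ≠ [] := by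
    rintro rfl
    exact h₁ x rfl rfl
  obtain ⟨y, t, rfl⟩ := List.exists_cons_of_ne_nil hne
  refine ⟨[], x, y :: t ++ [h], by simp, joins_singleton x, ?_, by simp, ?_, by simp, by simp, ?_⟩
  · have := (noBack_append_cons (x :: y :: t) h [x]).2 ⟨ht.2.2, ?_, ?_⟩
    · simpa using this
    · simpa using ht.1
    · simpa using h₁
  · rw [List.getLast?_concat]
    simpa using ht.2.1
  · have := walkVal_append_cons (x :: y :: t) h [x]
    simp only [List.cons_append, List.append_assoc, List.nil_append] at this ⊢
    rw [this]
    simp only [walkVal_cons_cons, walkVal_singleton, ← mul_assoc]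
    simp

theorem LoopVal.cons {x : X} (hγ : LoopVal a D γ) :
    LoopVal x D (edgeVal x a * γ * edgeVal a x) := by
  obtain ⟨b, h, t, hb, hj, ht, hD, h₁, h₂, h₃, hval⟩ := id hγ
  by_cases hxa : x = a
  · subst hxa
    simpa using hγ
  cases b with
  | cons c b =>
    obtain rfl : c = a := by simpa using hj.1
    obtain ⟨d, s, hds⟩ : ∃ d s, b ++ [h] = d :: s :=
      List.exists_cons_of_ne_nil (by simp)
    rw [List.cons_append, hds] at hb hj hval
    by_cases hxd : x = d
    · subst hxd
      refine ⟨b, h, t, hds ▸ hb.2.2, hds ▸ ⟨rfl, by simpa using hj.2⟩, ht, hD, h₁, ?_, ?_, ?_⟩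
      · cases b with
        | nil => simp
        | cons e b => simpa [List.getLast?_cons_cons] using h₂
      · cases b with
        | nil => simp
        | cons e b => simpa [List.getLast?_cons_cons] using h₃
      · rw [hval, hds, walkVal_cons_cons, ← edgeVal_inv x c]
        group
    · refine ⟨x :: c :: b, h, t, ?_, ?_, ht, hD, h₁, ?_, ?_, ?_⟩
      · rw [List.cons_append, List.cons_append, hds]
        exact ⟨hxa, by simpa using hxd, hb⟩
      · rw [List.cons_append, List.cons_append, hds]
        exact hj.cons
      · simpa [List.getLast?_cons_cons] using h₂
      · simpa [List.getLast?_cons_cons] using h₃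
      · rw [hval, List.cons_append, List.cons_append, hds, walkVal_cons_cons x, ← edgeVal_inv x c]
        group
  | nil =>
    obtain rfl : h = a := by simpa [Joins] using hj
    have hval' : γ = walkVal (h :: (t ++ [h])) := by simpa using hval
    by_cases hx₁ : ∃ s, t = x :: s
    · obtain ⟨s, rfl⟩ := hx₁
      rw [hval', ← hD]
      exact LoopVal.rotate ht (by simpa using h₁)
    by_cases hx₂ : ∃ s, t = s ++ [x]
    · obtain ⟨s, rfl⟩ := hx₂
      have e : (h :: ((s ++ [x]) ++ [h])).reverse = h :: (x :: s.reverse ++ [h]) := by simp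
      have hr := e ▸ ht.reverse
      have e' : x :: s.reverse = (s ++ [x]).reverse := by simp
      have := (LoopVal.rotate hr (by
        rw [e', List.getLast?_reverse]
        exact fun y hy => (h₁ x (by simp) y hy).symm)).inv
      rw [← e, walkVal_reverse] at this
      rw [hval', ← hD]
      simpa [edgeVal_inv, mul_assoc] using this
    · refine ⟨[x], h, t, by simpa using hxa, (joins_singleton h).cons, ht, hD, h₁, ?_, ?_, ?_⟩
      · simp only [List.getLast?_singleton, Option.mem_def, Option.some.injEq]
        rintro _ rfl y hy rfl
        exact hx₁ (by cases t <;> simp_all)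
      · simp only [List.getLast?_singleton, Option.mem_def, Option.some.injEq]
        rintro _ rfl y hy rfl
        exact hx₂ (List.getLast?_eq_some_iff.1 hy)
      · simp [hval', edgeVal_inv]

theorem LoopVal.conj {c : X} (hγ : LoopVal a D γ) {W : List X} (hW : Joins c a W) :
    LoopVal c D (walkVal W * γ * (walkVal W)⁻¹) := by
  induction W generalizing c with
  | nil => simp [Joins] at hW
  | cons x W ih =>
    obtain rfl : x = c := by simpa using hW.1
    cases W with
    | nil =>
      obtain rfl : x = a := by simpa using hW.2
      simpa using hγ
    | cons y W =>
      have := (ih ⟨rfl, by simpa using hW.2⟩).cons (x := x)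
      rw [← edgeVal_inv x y] at this
      convert this using 1
      rw [walkVal_cons_cons]
      group

theorem IsCycReduced.loopVal {R : List X} (h : IsCycReduced R) (hR : Joins a a R) :
    LoopVal a (wlen R) (walkVal R) := by
  obtain ⟨hred, hlen, hne⟩ := h
  rw [isReduced_iff_noBack] at hred
  obtain ⟨t, rfl⟩ := hR.exists_cons
  obtain rfl | ⟨t, b, rfl⟩ := t.eq_nil_or_concat'
  · simp at hlen
  obtain rfl : b = a := by
    have := hR.2
    rw [← List.cons_append, List.getLast?_concat] at this
    exact Option.some.inj this
  refine ⟨[], b, t, by simp, joins_singleton b, hred, by simp [wlen], ?_, by simp, by simp,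
    by simp⟩
  intro x hx y hy hxy
  subst hxy
  apply hne
  obtain rfl | ⟨s, z, rfl⟩ := t.eq_nil_or_concat'
  · simp at hx
  obtain rfl : z = x := by simpa using hx
  cases s with
  | nil => simp
  | cons w s =>
    obtain rfl : w = z := by simpa using hy
    simp

theorem LoopVal.pos (hγ : LoopVal a D γ) : 0 < D := by
  obtain ⟨b, h, t, -, -, -, rfl, -⟩ := hγ
  omega

/-- If a large power of a reduced loop times a short walk is symmetric, then the loop itself is
symmetric. -/
theorem LoopVal.symVal {H : Dgraph X} (hγ : LoopVal a D γ) {c : X} {Z : List X}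
    (hZ : Joins a c Z) {n : ℕ} (hn : wlen Z + D ≤ n * D) (hs : SymVal H a c (γ ^ n * walkVal Z)) :
    SymVal H a a γ := by
  have hD := hγ.pos
  obtain ⟨b, h, t, hb, hj, ht, rfl, h₁, h₂, h₃, rfl⟩ := hγ
  obtain ⟨y, t, rfl⟩ : ∃ y s, t = y :: s := List.exists_cons_of_ne_nil <| by
    rintro rfl
    exact ht.1 rfl
  have hpow : ∀ k : ℕ, ∃ r, NoBack (h :: r) ∧ Joins h a (h :: r) ∧
      r.length = k * ((y :: t).length + 1) + b.length ∧
      walkVal (h :: r) = walkVal (h :: (y :: t ++ [h])) ^ k * (walkVal (b ++ [h]))⁻¹ ∧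
      ∀ x ∈ (y :: t).getLast?, ∀ z ∈ r.head?, x ≠ z := by
    intro k
    induction k with
    | zero =>
      have e : (b ++ [h]).reverse = h :: b.reverse := by simp
      refine ⟨b.reverse, e ▸ hb.reverse, e ▸ hj.reverse, by simp, ?_, ?_⟩
      · rw [← e, walkVal_reverse, pow_zero, one_mul]
      · simpa using fun x hx z hz => (h₃ z hz x hx).symm
    | succ k ih =>
      obtain ⟨r, hr, jr, lr, vr, er⟩ := ih
      refine ⟨y :: t ++ h :: r, ?_, ?_, ?_, ?_, by simpa using h₁⟩
      · exact (noBack_append_cons (h :: y :: t) h r).2 ⟨ht, hr, by simpa using er⟩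
      · have : Joins h h (h :: (y :: t ++ [h])) := ⟨rfl, by simp [List.getLast?_cons]⟩
        simpa [wcomp] using this.wcomp jr
      · simp only [List.length_append, List.length_cons] at lr ⊢
        rw [lr]
        ring
      · have := walkVal_append_cons (h :: y :: t) h r
        simp only [List.cons_append] at this vr ⊢
        rw [this, vr, pow_succ']
        simp only [mul_assoc]
  obtain ⟨k, rfl⟩ : ∃ k, n = k + 1 := Nat.exists_eq_succ_of_ne_zero <| by
    rintro rfl
    omega
  obtain ⟨r, hr, jr, lr, vr, er⟩ := hpow k
  have hbt : NoBack (h :: (y :: t ++ h :: r)) :=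
    (noBack_append_cons (h :: y :: t) h r).2 ⟨ht, hr, by simpa using er⟩
  have hl : NoBack (b ++ h :: (y :: t ++ h :: r)) :=
    (noBack_append_cons b h _).2 ⟨hb, hbt, by simpa using h₂⟩
  have jT : Joins h h (h :: (y :: t ++ [h])) := ⟨rfl, by simp [List.getLast?_cons]⟩
  have hlj : Joins a a (b ++ h :: (y :: t ++ h :: r)) := by
    simpa [wcomp] using hj.wcomp (jT.wcomp jr)
  have hlval : walkVal (b ++ h :: (y :: t ++ h :: r)) =
      (walkVal (b ++ [h]) * walkVal (h :: (y :: t ++ [h])) * (walkVal (b ++ [h]))⁻¹) ^ (k + 1) := by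
    rw [conj_pow, pow_succ', mul_assoc, mul_assoc, ← vr, ← jT.walkVal_wcomp jr,
      walkVal_append_cons]
    simp [wcomp]
  obtain ⟨m, hm, jm, pm, em⟩ := hl.exists_mul hlj hZ
  obtain ⟨S, hS, jS, sS, eS⟩ := hs.exists_noBack
  obtain rfl : m = S := hm.eq_of_walkVal_eq hS jm jS (by rw [em, eS, hlval])
  have hpre : b ++ h :: (y :: t ++ [h]) <+: m := by
    refine List.IsPrefix.trans (List.prefix_take_iff.2 ⟨⟨r, by simp⟩, ?_⟩) pm
    simp only [List.length_append, List.length_cons, List.length_nil] at lr hn ⊢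
    rw [Nat.succ_mul] at hn
    rw [lr]
    generalize k * (t.length + 1 + 1) = M at hn
    omega
  obtain ⟨s, rfl⟩ := hpre
  have hsym : IsSymWalk H (b ++ h :: (y :: t ++ [h])) :=
    List.IsChain.left_of_append sS
  rw [isSymWalk_append_cons] at hsym
  have hB : SymVal H a h _ := ⟨_, hj, hsym.1, rfl⟩
  exact (hB.mul ⟨_, jT, hsym.2, rfl⟩).mul hB.inv

end ReducedLoop

end HRecoloring

namespace HRecoloring

variable {V X : Type}

section Realizability

variable {G : Dgraph V} {H : Dgraph X} {α β : V → X} {q : V}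

theorem Dgraph.WConn.exists_short_walk [Fintype V] (hG : G.WConn) (u v : V) :
    ∃ W, Joins u v W ∧ W.IsChain G.UAdj ∧ wlen W < Fintype.card V := by
  obtain ⟨l, hl⟩ := hG u v
  have hreach : (SimpleGraph.fromRel G.Adj).Reachable u v := by
    have hj := hl.joins
    have hc : l.IsChain G.UAdj := hl.2.2.2
    clear hl
    induction l generalizing u with
    | nil => simp [Joins] at hj
    | cons x l ih =>
      obtain rfl : x = u := by simpa using hj.1
      cases l with
      | nil =>
        obtain rfl : x = v := by simpa using hj.2
        exact .rfl
      | cons y l =>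
        rw [List.isChain_cons_cons] at hc
        refine SimpleGraph.Reachable.trans ?_ (ih y ⟨rfl, by simpa using hj.2⟩ hc.2)
        by_cases hxy : x = y
        · exact hxy ▸ .rfl
        · exact SimpleGraph.Adj.reachable ((SimpleGraph.fromRel_adj _ _ _).2 ⟨hxy, hc.1⟩)
  obtain ⟨p, hp⟩ := hreach.exists_isPath
  refine ⟨p.support, ⟨?_, ?_⟩, ?_, ?_⟩
  · rw [List.head?_eq_some_head p.support_ne_nil, p.head_support]
  · rw [List.getLast?_eq_some_getLast p.support_ne_nil, p.getLast_support]
  · exact p.isChain_adj_support.imp fun _ _ h => ((SimpleGraph.fromRel_adj _ _ _).1 h).2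
  · simpa [wlen] using hp.length_lt

theorem joins_witer {R : List X} {a : X} (hR : Joins a a R) (n : ℕ) :
    Joins a a (witer R a n) := by
  induction n with
  | zero => exact joins_singleton a
  | succ n ih => exact hR.wcomp ih

theorem walkVal_witer {R : List X} {a : X} (hR : Joins a a R) (n : ℕ) :
    walkVal (witer R a n) = walkVal R ^ n := by
  induction n with
  | zero => rfl
  | succ n ih => rw [witer, hR.walkVal_wcomp (joins_witer hR n), ih, pow_succ']

theorem joins_zpowWalk {R : List X} {a : X} (hR : Joins a a R) (n : ℤ) :
    Joins a a (zpowWalk R a n) := by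
  unfold zpowWalk
  split_ifs
  · exact joins_witer hR _
  · exact joins_witer hR.reverse _

theorem walkVal_zpowWalk {R : List X} {a : X} (hR : Joins a a R) (n : ℤ) :
    walkVal (zpowWalk R a n) = walkVal R ^ n := by
  unfold zpowWalk
  split_ifs with h
  · rw [walkVal_witer hR, ← zpow_natCast, Int.toNat_of_nonneg h]
  · rw [walkVal_witer hR.reverse, walkVal_reverse, ← zpow_natCast,
      Int.toNat_of_nonneg (by omega), inv_zpow, zpow_neg, inv_inv]

theorem joins_conj {W : List V} {v : V} {P : List X} (hW : Joins q v W)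
    (hP : Joins (α q) (β q) P) : Joins (α v) (β v) (conj α β W P) :=
  ((hW.map α).reverse.wcomp hP).wcomp (hW.map β)

theorem walkVal_conj {W : List V} {v : V} {P : List X} (hW : Joins q v W)
    (hP : Joins (α q) (β q) P) :
    walkVal (conj α β W P) = (walkVal (W.map α))⁻¹ * walkVal P * walkVal (W.map β) := by
  have h := (hW.map α).reverse
  rw [conj, (h.wcomp hP).walkVal_wcomp (hW.map β), h.walkVal_wcomp hP, walkVal_reverse]

theorem wlen_conj_le {W : List V} {P : List X} (hP : P ≠ []) :
    wlen (conj α β W P) ≤ wlen P + 2 * wlen W := by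
  have := List.length_pos_iff.2 hP
  simp only [conj, wcomp, wlen, List.length_append, List.length_tail, List.length_reverse,
    List.length_map]
  omega

theorem isChain_move {σs : List (V → X)} (h : Hom1Seq G H σs) (hp : PushOrPull G σs) :
    σs.IsChain (Move G) :=
  List.isChain_iff_getElem.2 fun i hi =>
    ⟨(List.isChain_iff_getElem.1 h.2.2 i hi).1, List.isChain_iff_getElem.1 hp i hi⟩

theorem DRealizable.exists_moves {Q : List X} (h : DRealizable G H α β q Q) :
    ∃ σs : List (V → X), Hom1Seq G H σs ∧ Joins α β σs ∧ walkVal (colorWalk σs q) = walkVal Q ∧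
      Moves (Move G) β α fun v => walkVal (colorWalk σs v) := by
  obtain ⟨σs, hσs, hh, hl, hp, hQ⟩ := h
  exact ⟨σs, hσs, ⟨hh, hl⟩, hQ.walkVal_eq, moves_of_isChain ⟨hh, hl⟩ (isChain_move hσs hp)⟩

theorem Move.of_usym {σ σ' : V → X} (h : Move G.usym σ σ') : Move G σ σ' :=
  ⟨h.1, fun u hu w hw => h.2 u hu w (.inl hw)⟩

theorem Moves.mono {r r' : (V → X) → (V → X) → Prop} (hr : ∀ σ σ', r σ σ' → r' σ σ')
    {g : V → FreeGroup (X × X)} (h : Moves r β α g) : Moves r' β α g := by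
  induction h with
  | refl => exact .refl
  | step h _ ih => exact .step (hr _ _ h) ih

theorem Hom1Seq.symVal (hG : G.IsReflexive) {σs : List (V → X)} (h : Hom1Seq G H σs)
    (hj : Joins α β σs) (v : V) : SymVal H (α v) (β v) (walkVal (colorWalk σs v)) := by
  refine ⟨_, hj.map fun σ => σ v, ?_, rfl⟩
  rw [isSymWalk_iff, List.isChain_map]
  exact h.2.2.imp fun _ _ h => h.2 (hG v)

theorem SymMove.hom1Adj (hH : H.IsReflexive) {σ σ' : V → X} (h : SymMove G H σ σ')
    (hσ : IsHom G H σ) : Hom1Adj G H σ σ' ∧ IsHom G H σ' := by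
  obtain ⟨⟨hu, hpp⟩, hs⟩ := h
  have hcross : ∀ ⦃x y⦄, G.UAdj x y → σ x ≠ σ' x →
      (H.Adj (σ' x) (σ y) ∧ H.Adj (σ y) (σ' x)) := by
    intro x y hxy hx
    rcases hpp x hx y hxy with e | e
    · rw [e]
      exact (hs x hx).symm
    · rw [e]
      exact ⟨hH _, hH _⟩
  have hadj : ∀ ⦃x y⦄, G.Adj x y → H.Adj (σ x) (σ' y) ∧ H.Adj (σ' x) (σ y) := by
    intro x y hxy
    constructor
    · by_cases hy : σ y = σ' y
      · exact hy ▸ hσ hxy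
      · exact (hcross (.inr hxy) hy).2
    · by_cases hx : σ x = σ' x
      · exact hx ▸ hσ hxy
      · exact (hcross (.inl hxy) hx).1
  refine ⟨⟨hu, hadj⟩, fun x y hxy => ?_⟩
  by_cases hx : σ x = σ' x
  · exact hx ▸ (hadj hxy).1
  · by_cases hy : σ y = σ' y
    · exact hy ▸ (hadj hxy).2
    · obtain rfl := hu.unique hx hy
      exact hH _

theorem hom1Seq_of_isChain (hH : H.IsReflexive) {σs : List (V → X)} (hj : Joins α β σs)
    (hα : IsHom G H α) (hc : σs.IsChain (SymMove G H)) : Hom1Seq G H σs := by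
  induction σs generalizing α with
  | nil => simp [Joins] at hj
  | cons σ σs ih =>
    obtain rfl : σ = α := by simpa using hj.1
    cases σs with
    | nil => exact ⟨by simp, by simpa using hα, List.isChain_singleton _⟩
    | cons σ' σs =>
      rw [List.isChain_cons_cons] at hc
      obtain ⟨hadj, hσ'⟩ := hc.1.hom1Adj hH hα
      obtain ⟨-, hhom, hch⟩ := ih ⟨rfl, by simpa using hj.2⟩ hσ' hc.2
      exact ⟨by simp, by simpa using ⟨hα, by simpa using hhom⟩,
        List.isChain_cons_cons.2 ⟨hadj, hch⟩⟩

theorem Moves.dRealizable (hH : H.IsReflexive) (hα : IsHom G H α) {g : V → FreeGroup (X × X)}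
    (h : Moves (SymMove G H) β α g) {Q : List X} (hQ : Joins (α q) (β q) Q)
    (hg : g q = walkVal Q) : DRealizable G H α β q Q := by
  obtain ⟨σs, hj, hc, hv⟩ := h.exists_isChain
  refine ⟨σs, hom1Seq_of_isChain hH hj hα hc, hj.1, hj.2, hc.imp fun _ _ h => h.1.2, ?_⟩
  exact piEq_of_walkVal_eq (hj.map fun σ => σ q) hQ ((hv q).trans hg)

theorem le_cdiv_mul {a b : ℕ} (hb : 0 < b) : a ≤ cdiv a b * b := by
  have h := Nat.div_add_mod (a + b - 1) b
  have h' := Nat.mod_lt (a + b - 1) hb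
  rw [mul_comm] at h
  unfold cdiv
  omega

theorem LoopVal.symVal_zpow {a : X} {D : ℕ} {γ : FreeGroup (X × X)} (hγ : LoopVal a D γ) {c : X}
    {Z : List X} (hZ : Joins a c Z) {n : ℤ} (hn : wlen Z + D ≤ n.natAbs * D)
    (hs : SymVal H a c (γ ^ n * walkVal Z)) (m : ℤ) : SymVal H a c (γ ^ m * walkVal Z) := by
  have h : SymVal H a a γ := by
    rcases n.natAbs_eq with e | e
    · rw [e, zpow_natCast] at hs
      exact hγ.symVal hZ hn hs
    · rw [e, zpow_neg, ← inv_zpow, zpow_natCast] at hs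
      simpa using (hγ.inv.symVal hZ hn hs).inv
  have := (h.zpow (m - n)).mul hs
  rwa [← mul_assoc, ← zpow_add, sub_add_cancel] at this

end Realizability

end HRecoloring

open HRecoloring
/-- If the set of `\bar H`-realizable walks for `α, β, q` equals
`{RⁿP : n ∈ ℤ}` with `R = A · R₀ · A⁻¹` (`A` reduced, `R₀` cyclically
reduced), and `RⁿP` is not `H`-realizable for every `|n| ≤ N` where
`N = 3⌈|V(G)|/|R₀|⌉ + ⌈(|P| + |V(G)|)/|R₀|⌉`, then `RⁿP` is not
`H`-realizable for every `n ∈ ℤ`. -/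
theorem statement19 {V X : Type} [Fintype V] [Fintype X]
    (G : Dgraph V) (H : Dgraph X)
    (hGrefl : G.IsReflexive) (hHrefl : H.IsReflexive)
    (hGconn : G.WConn) (hHconn : H.WConn)
    (α β : V → X) (hα : IsHom G H α) (hβ : IsHom G H β)
    (q : V) (h₀ : X) (R A R₀ P : List X)
    (hR : IsWalk H (α q) (α q) R)
    (hA : IsWalk H (α q) h₀ A) (hAred : IsReduced A)
    (hR₀ : IsWalk H h₀ h₀ R₀) (hR₀cr : IsCycReduced R₀)
    (hdecomp : R = wcomp (wcomp A R₀) A.reverse)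
    (hP : IsWalk H (α q) (β q) P) (hPred : IsReduced P)
    (hbar : {Q : List X | IsWalk H (α q) (β q) Q ∧ IsReduced Q ∧
        DRealizable G.usym H.usym α β q Q} =
      {Q : List X | IsReduced Q ∧
        ∃ n : ℤ, PiEq (wcomp (zpowWalk R (α q) n) P) Q}) :
    (∀ n : ℤ, n.natAbs ≤ 3 * cdiv (Fintype.card V) (wlen R₀) +
        cdiv (wlen P + Fintype.card V) (wlen R₀) →
      ¬ DRealizable G H α β q (wcomp (zpowWalk R (α q) n) P)) →
    ∀ n : ℤ, ¬ DRealizable G H α β q (wcomp (zpowWalk R (α q) n) P) := by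
  intro hN n hn
  obtain ⟨k, hk⟩ : ∃ k, 3 * cdiv (Fintype.card V) (wlen R₀) +
      cdiv (wlen P + Fintype.card V) (wlen R₀) = k := ⟨_, rfl⟩
  rw [hk] at hN
  have hlarge : k < n.natAbs := by
    by_contra! hle
    exact hN n hle hn
  refine hN 0 (Nat.zero_le k) ?_
  have hRP : ∀ i : ℤ, Joins (α q) (β q) (wcomp (zpowWalk R (α q) i) P) ∧
      walkVal (wcomp (zpowWalk R (α q) i) P) = walkVal R ^ i * walkVal P := fun i =>
    ⟨(joins_zpowWalk hR.joins i).wcomp hP.joins, by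
      rw [(joins_zpowWalk hR.joins i).walkVal_wcomp hP.joins, walkVal_zpowWalk hR.joins]⟩
  have hloop : LoopVal (α q) (wlen R₀) (walkVal R) := by
    rw [hdecomp, (hA.joins.wcomp hR₀.joins).walkVal_wcomp hA.joins.reverse,
      hA.joins.walkVal_wcomp hR₀.joins, walkVal_reverse]
    exact (hR₀cr.loopVal hR₀.joins).conj hA.joins
  have hlen : wlen P + 2 * Fintype.card V + wlen R₀ ≤ n.natAbs * wlen R₀ := by
    have h₁ := le_cdiv_mul (a := Fintype.card V) hloop.pos
    have h₂ := le_cdiv_mul (a := wlen P + Fintype.card V) hloop.pos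
    have h₃ := Nat.mul_le_mul_right (wlen R₀) (Nat.succ_le_of_lt hlarge)
    rw [← hk, Nat.succ_mul, add_mul, mul_assoc] at h₃
    omega
  obtain ⟨σs, hσs, hj, hσq, hmov⟩ := hn.exists_moves
  have hsym : ∀ g, Moves (Move G) β α g → g q = walkVal R ^ (0 : ℤ) * walkVal P →
      ∀ v, SymVal H (α v) (β v) (g v) := by
    intro g hg hgq v
    obtain ⟨W, hW, hWc, hWlen⟩ := hGconn.exists_short_walk q v
    have hval : ∀ (i : ℤ) (g : V → FreeGroup (X × X)), Moves (Move G) β α g →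
        g q = walkVal R ^ i * walkVal P →
        g v = (walkVal (W.map α).reverse * walkVal R * (walkVal (W.map α).reverse)⁻¹) ^ i *
          walkVal (conj α β W P) := by
      intro i g hg hgq
      have h := hg.walk hW hWc
      rw [hgq] at h
      rw [conj_zpow, walkVal_conj hW hP.joins, walkVal_reverse, eq_inv_mul_of_mul_eq h.symm]
      group
    have hS := hσs.symVal hGrefl hj v
    rw [hval n _ hmov (hσq.trans (hRP n).2)] at hS
    rw [hval 0 g hg hgq]
    refine (hloop.conj (hW.map α).reverse).symVal_zpow (joins_conj hW hP.joins) ?_ hS 0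
    have := wlen_conj_le (α := α) (β := β) (W := W) hP.1
    omega
  obtain ⟨Q, hQ, hPQ, -⟩ := exists_isReduced_of_stable (p := fun _ => True) (by simp)
    (wcomp (zpowWalk R (α q) 0) P) trivial
  have hQmem : Q ∈ {Q : List X | IsReduced Q ∧
      ∃ n : ℤ, PiEq (wcomp (zpowWalk R (α q) n) P) Q} := ⟨hQ, 0, hPQ⟩
  rw [← hbar] at hQmem
  obtain ⟨τs, -, -, hτq, hτ⟩ := hQmem.2.2.exists_moves
  rw [← hPQ.walkVal_eq] at hτq
  have hτ' := hτ.mono fun _ _ => Move.of_usym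
  choose f hf hfj hfs hfv using
    fun v => (hsym _ hτ' (hτq.trans (hRP 0).2) v).exists_noBack
  simp only [← hfv] at hτ'
  exact (hτ'.symMoves hf hfj hfs).dRealizable hHrefl hα (hRP 0).1
    ((hfv q).trans hτq)
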